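/- Let a, b be integers, let k and m be coprime positive integers, and let n = k·m. Then there exists an integer P satisfying simultaneously: ι_{k,n}(a,b) = P · ι_{1,m}(a,b), ι_{m,n}(a,b) = P · ι_{1,k}(a,b), and ι_{1,n}(a,b) = P · ι_{1,k}(a,b) · ι_{1,m}(a,b). -/

import Mathlib

/-- The integer `ι_{p,q}(a,b) = Σ_{ℓ=0}^{q/p − 1} b^{q−(ℓ+1)p} · a^{ℓ·p}`. -/
def iotaInt (a b : ℤ) (p q : ℕ) : ℤ :=
  ∑ ℓ ∈ Finset.range (q / p), b ^ (q - (ℓ + 1) * p) * a ^ (ℓ * p)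

open Polynomial in
theorem geom_sum_mul_geom_sum_pow (k m : ℕ) :
    (∑ i ∈ Finset.range k, (X : ℤ[X]) ^ i) * ∑ i ∈ Finset.range m, ((X : ℤ[X]) ^ k) ^ i =
      ∑ i ∈ Finset.range (k * m), (X : ℤ[X]) ^ i := by
  have h : (X - 1 : ℤ[X]) ≠ 0 := (monic_X_sub_C (1 : ℤ)).ne_zero
  apply mul_left_cancel₀ h
  rw [← mul_assoc, mul_geom_sum, mul_geom_sum, mul_geom_sum, pow_mul]

theorem geom_sum_dvd_geom_sum_sub_mod {R : Type*} [CommRing R] (x : R) (m n : ℕ) :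
    ∑ i ∈ Finset.range m, x ^ i ∣
      ∑ i ∈ Finset.range n, x ^ i - ∑ i ∈ Finset.range (n % m), x ^ i := by
  have key (c q : ℕ) : ∑ i ∈ Finset.range m, x ^ i ∣
      ∑ i ∈ Finset.range (c + m * q), x ^ i - ∑ i ∈ Finset.range c, x ^ i := by
    induction q with
    | zero => simp
    | succ q ih =>
      rw [Nat.mul_succ, ← add_assoc, Finset.sum_range_add, add_sub_right_comm]
      refine dvd_add ih ?_
      simp only [pow_add _ (c + m * q), ← Finset.mul_sum]
      exact dvd_mul_left _ _
  simpa [Nat.mod_add_div] using key (n % m) (n / m)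

theorem isCoprime_geom_sum {R : Type*} [CommRing R] (x : R) {m n : ℕ} (h : Nat.Coprime m n) :
    IsCoprime (∑ i ∈ Finset.range m, x ^ i) (∑ i ∈ Finset.range n, x ^ i) := by
  induction m, n using Nat.gcd.induction with
  | H0 n =>
    obtain rfl : n = 1 := by simpa using h
    simpa using isCoprime_one_right
  | H1 m n hm ih =>
    obtain ⟨z, hz⟩ := geom_sum_dvd_geom_sum_sub_mod x m n
    rw [sub_eq_iff_eq_add'.mp hz]
    refine IsCoprime.add_mul_left_right (ih ?_).symm z
    rwa [Nat.Coprime, ← Nat.gcd_rec]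

open Polynomial in
theorem natDegree_geom_sum_X_pow_le (p m : ℕ) :
    (∑ i ∈ Finset.range m, ((X : ℤ[X]) ^ p) ^ i).natDegree ≤ p * (m - 1) := by
  refine natDegree_sum_le_of_forall_le _ _ fun i hi => ?_
  rw [← pow_mul, natDegree_X_pow]
  exact Nat.mul_le_mul_left p (Nat.le_sub_one_of_lt (Finset.mem_range.mp hi))

open Polynomial in
theorem natDegree_geom_sum_X {m : ℕ} (hm : 0 < m) :
    (∑ i ∈ Finset.range m, (X : ℤ[X]) ^ i).natDegree = m - 1 := by
  apply le_antisymm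
  · simpa using natDegree_geom_sum_X_pow_le 1 m
  · apply le_natDegree_of_ne_zero
    simp [coeff_X_pow, hm]

open Polynomial in
theorem iotaInt_eq_eval_homogenize (a b : ℤ) {p : ℕ} (hp : 0 < p) (m : ℕ) :
    iotaInt a b p (p * m) = MvPolynomial.eval ![a, b]
      ((∑ i ∈ Finset.range m, ((X : ℤ[X]) ^ p) ^ i).homogenize (p * (m - 1))) := by
  rw [iotaInt, Nat.mul_div_cancel_left m hp, homogenize_finsetSum, map_sum]
  refine Finset.sum_congr rfl fun i hi => ?_
  have hi' : i ≤ m - 1 := Nat.le_sub_one_of_lt (Finset.mem_range.mp hi)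
  rw [← pow_mul, homogenize_X_pow (Nat.mul_le_mul_left p hi')]
  have h : p * m - (i + 1) * p = p * (m - 1) - p * i := by
    rw [mul_comm (i + 1), ← Nat.mul_sub, ← Nat.mul_sub]
    congr 1
    omega
  simp [h, mul_comm (b ^ _), mul_comm i p]

open Polynomial in
/-- Coprime `k`, `m` make the geometric sum of length `m` in `X` divide the one in `X ^ k`. -/
theorem exists_geom_sum_X_pow_eq_mul {k m : ℕ} (hk : 0 < k) (hkm : Nat.Coprime k m) :
    ∃ P : ℤ[X],
      ∑ i ∈ Finset.range m, ((X : ℤ[X]) ^ k) ^ i = P * ∑ i ∈ Finset.range m, X ^ i ∧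
      ∑ i ∈ Finset.range k, ((X : ℤ[X]) ^ m) ^ i = P * ∑ i ∈ Finset.range k, X ^ i := by
  have hmul : (∑ i ∈ Finset.range m, (X : ℤ[X]) ^ i) *
      ∑ i ∈ Finset.range k, ((X : ℤ[X]) ^ m) ^ i =
      (∑ i ∈ Finset.range k, (X : ℤ[X]) ^ i) * ∑ i ∈ Finset.range m, ((X : ℤ[X]) ^ k) ^ i := by
    rw [geom_sum_mul_geom_sum_pow, geom_sum_mul_geom_sum_pow, mul_comm]
  obtain ⟨P, hP⟩ := (isCoprime_geom_sum (X : ℤ[X]) hkm).dvd_of_dvd_mul_right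
    (Dvd.intro _ (by rw [← hmul, mul_comm]) :
      ∑ i ∈ Finset.range k, (X : ℤ[X]) ^ i ∣ (∑ i ∈ Finset.range k, ((X : ℤ[X]) ^ m) ^ i) *
        ∑ i ∈ Finset.range m, (X : ℤ[X]) ^ i)
  refine ⟨P, ?_, by rw [hP, mul_comm]⟩
  apply mul_left_cancel₀ (monic_geom_sum_X (R := ℤ) hk.ne').ne_zero
  rw [← hmul, hP]
  ring

/-- for integers `a`, `b`, coprime positive integers `k`, `m` and `n = k·m`,
there is an integer `P` with `ι_{k,n} = P·ι_{1,m}`, `ι_{m,n} = P·ι_{1,k}` and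
`ι_{1,n} = P·ι_{1,k}·ι_{1,m}`. -/
theorem iotaInt_factorization (a b : ℤ) (k m : ℕ) (hk : 0 < k) (hm : 0 < m)
    (hkm : Nat.Coprime k m) (n : ℕ) (hn : n = k * m) :
    ∃ P : ℤ,
      iotaInt a b k n = P * iotaInt a b 1 m ∧
      iotaInt a b m n = P * iotaInt a b 1 k ∧
      iotaInt a b 1 n = P * iotaInt a b 1 k * iotaInt a b 1 m := by
  subst hn
  obtain ⟨P, hPm, hPk⟩ := exists_geom_sum_X_pow_eq_mul hk hkm
  have hm0 := (Polynomial.monic_geom_sum_X (R := ℤ) hm.ne').ne_zero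
  have hdeg : P.natDegree ≤ (k - 1) * (m - 1) := by
    have h := natDegree_geom_sum_X_pow_le k m
    have hP0 : P ≠ 0 := by
      rintro rfl
      have h1 := congrArg (Polynomial.eval 1) hPm
      simp [Polynomial.eval_finsetSum, hm.ne'] at h1
    rw [hPm, Polynomial.natDegree_mul hP0 hm0, natDegree_geom_sum_X hm] at h
    rw [Nat.sub_one_mul]
    exact Nat.le_sub_of_add_le h
  have hhom {l p : ℕ} (hl : 0 < l) (hp : 0 < p) (hd : (k - 1) * (m - 1) + (l - 1) = p * (l - 1))
      (h : ∑ i ∈ Finset.range l, ((Polynomial.X : Polynomial ℤ) ^ p) ^ i =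
        P * ∑ i ∈ Finset.range l, Polynomial.X ^ i) :
      iotaInt a b p (p * l) =
        MvPolynomial.eval ![a, b] (P.homogenize ((k - 1) * (m - 1))) * iotaInt a b 1 l := by
    have h1 := iotaInt_eq_eval_homogenize a b one_pos l
    simp only [one_mul, pow_one] at h1
    rw [iotaInt_eq_eval_homogenize a b hp, h1, h, ← hd,
      Polynomial.homogenize_mul _ _ hdeg (natDegree_geom_sum_X hl).le, map_mul]
  have hk' := hhom hm hk (by rw [← Nat.succ_mul, Nat.succ_eq_add_one, Nat.sub_add_cancel hk]) hPm
  have hm' := hhom hk hm (by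
    rw [mul_comm, ← Nat.succ_mul, Nat.succ_eq_add_one, Nat.sub_add_cancel hm]) hPk
  refine ⟨_, hk', by rwa [mul_comm m k] at hm', ?_⟩
  have hk1 := iotaInt_eq_eval_homogenize a b one_pos k
  have hn1 := iotaInt_eq_eval_homogenize a b one_pos (k * m)
  simp only [one_mul, pow_one] at hk1 hn1
  have hd : k * m - 1 = (k - 1) + k * (m - 1) := by
    obtain ⟨m, rfl⟩ := Nat.exists_eq_add_of_le' hm
    rw [Nat.add_sub_cancel, Nat.mul_succ]
    omega
  rw [mul_right_comm, ← hk', hn1, ← geom_sum_mul_geom_sum_pow, hd,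
    Polynomial.homogenize_mul _ _ (natDegree_geom_sum_X hk).le (natDegree_geom_sum_X_pow_le k m),
    map_mul, ← hk1, ← iotaInt_eq_eval_homogenize a b hk, mul_comm]
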